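/- The monoid G_Hii⁺ admits neither the left-divisibility theory nor the right-divisibility theory; that is, it is NOT the case that every pair of elements of G_Hii⁺ has a left least common multiple, and it is NOT the case that every pair of elements of G_Hii⁺ has a right least common multiple. -/

import Mathlib

/-- The three generators. -/
inductive Gen3 : Type
  | a | b | c

open FreeGroup in
/-- The defining relations of `G_Hii`. -/
def theRels : Set (FreeGroup Gen3) :=
  { of .a * of .b * of .a * of .b * (of .b * of .a * of .b * of .a)⁻¹,
    of .a * of .c * of .a * (of .b * of .a * of .c)⁻¹,
    of .a * of .c * of .a * of .c * of .a * (of .c * of .a * of .c * of .a * of .c)⁻¹ }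

/-- The group `G_Hii`. -/
abbrev G : Type := PresentedGroup theRels

/-- The monoid `G_Hii⁺`: the submonoid of `G_Hii` generated by the images of `a, b, c`. -/
abbrev Gplus : Submonoid G :=
  Submonoid.closure {PresentedGroup.of Gen3.a, PresentedGroup.of Gen3.b, PresentedGroup.of Gen3.c}

instance : Fintype Gen3 :=
  ⟨⟨([.a, .b, .c] : List Gen3), by simp⟩, by rintro (_ | _ | _) <;> simp⟩

namespace Gen3

/-- The images of the generators under a surjection of `G` onto the alternating group of degree
five. -/
def toPerm : Gen3 → Equiv.Perm (Fin 5)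
  | a => ⟨![0, 1, 3, 4, 2], ![0, 1, 4, 2, 3], by decide, by decide⟩
  | b => ⟨![4, 1, 0, 3, 2], ![2, 1, 4, 3, 0], by decide, by decide⟩
  | c => ⟨![1, 2, 0, 3, 4], ![2, 0, 1, 3, 4], by decide, by decide⟩

lemma toPerm_rels : ∀ r ∈ theRels, FreeGroup.lift toPerm r = 1 := by
  rintro r (rfl | rfl | rfl) <;> simp only [map_mul, map_inv, FreeGroup.lift_apply_of] <;> decide

lemma degree_rels :
    ∀ r ∈ theRels, FreeGroup.lift (fun _ : Gen3 => Multiplicative.ofAdd (1 : ℤ)) r = 1 := by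
  rintro r (rfl | rfl | rfl) <;> simp only [map_mul, map_inv, FreeGroup.lift_apply_of] <;> decide

end Gen3

namespace G

open Gen3

/-- The image in `G` of a generator. -/
abbrev gen (s : Gen3) : G := PresentedGroup.of s

/-- The permutation representation of `G` of degree five. -/
def permHom : G →* Equiv.Perm (Fin 5) := PresentedGroup.toGroup toPerm_rels

/-- The homomorphism to the integers sending every generator to `1`. -/
def degree : G →* Multiplicative ℤ := PresentedGroup.toGroup degree_rels

@[simp]
lemma permHom_gen (s : Gen3) : permHom (gen s) = s.toPerm :=
  PresentedGroup.toGroup.of toPerm_rels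

@[simp]
lemma degree_gen (s : Gen3) : degree (gen s) = Multiplicative.ofAdd 1 :=
  PresentedGroup.toGroup.of degree_rels

/-- The element of `G` spelled by a positive word. -/
def word (l : List Gen3) : G := (l.map gen).prod

@[simp]
lemma word_nil : word [] = 1 := rfl

@[simp]
lemma word_cons (s : Gen3) (l : List Gen3) : word (s :: l) = gen s * word l := by
  simp [word]

lemma word_append (l k : List Gen3) : word (l ++ k) = word l * word k := by
  simp [word]

lemma degree_word (l : List Gen3) : degree (word l) = Multiplicative.ofAdd (l.length : ℤ) := by
  induction l with
  | nil => simp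
  | cons s l ih => simp [ih, ← ofAdd_add, add_comm]

lemma length_eq_of_word_eq {l k : List Gen3} (h : word l = word k) : l.length = k.length := by
  simpa [degree_word] using congrArg degree h

lemma gen_mem_Gplus (s : Gen3) : gen s ∈ Gplus :=
  Submonoid.subset_closure (by cases s <;> simp)

lemma word_mem_Gplus (l : List Gen3) : word l ∈ Gplus := by
  induction l with
  | nil => exact one_mem _
  | cons s l ih => rw [word_cons]; exact mul_mem (gen_mem_Gplus s) ih

lemma exists_eq_word {g : G} (hg : g ∈ Gplus) : ∃ l, g = word l := by
  induction hg using Submonoid.closure_induction with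
  | mem x hx =>
    rcases hx with rfl | rfl | rfl
    exacts [⟨[.a], by simp⟩, ⟨[.b], by simp⟩, ⟨[.c], by simp⟩]
  | one => exact ⟨[], rfl⟩
  | mul x y _ _ hx hy =>
    obtain ⟨l, rfl⟩ := hx
    obtain ⟨k, rfl⟩ := hy
    exact ⟨l ++ k, (word_append l k).symm⟩

lemma abab_eq_baba : word [.a, .b, .a, .b] = word [.b, .a, .b, .a] := by
  have h : PresentedGroup.mk theRels _ = 1 :=
    PresentedGroup.one_of_mem (rels := theRels) (Or.inl rfl)
  rw [map_mul, map_inv, mul_inv_eq_one] at h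
  simp only [map_mul, mul_assoc] at h
  simp only [word_cons, word_nil, mul_one]
  exact h

lemma aca_eq_bac : word [.a, .c, .a] = word [.b, .a, .c] := by
  have h : PresentedGroup.mk theRels _ = 1 :=
    PresentedGroup.one_of_mem (rels := theRels) (Or.inr (Or.inl rfl))
  rw [map_mul, map_inv, mul_inv_eq_one] at h
  simp only [map_mul, mul_assoc] at h
  simp only [word_cons, word_nil, mul_one]
  exact h

lemma acaca_eq_cacac : word [.a, .c, .a, .c, .a] = word [.c, .a, .c, .a, .c] := by
  have h : PresentedGroup.mk theRels _ = 1 :=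
    PresentedGroup.one_of_mem (rels := theRels) (Or.inr (Or.inr rfl))
  rw [map_mul, map_inv, mul_inv_eq_one] at h
  simp only [map_mul, mul_assoc] at h
  simp only [word_cons, word_nil, mul_one]
  exact h

/-- Since `acb·ac = ac·aca = cacac = cac·ac`, one has `acb = cac` in `G`. -/
lemma acb_eq_cac : word [.a, .c, .b] = word [.c, .a, .c] := by
  refine mul_right_cancel (b := word [.a, .c]) ?_
  calc word [.a, .c, .b] * word [.a, .c]
      = word [.a, .c] * word [.b, .a, .c] := by simp [mul_assoc]
    _ = word [.a, .c] * word [.a, .c, .a] := by rw [aca_eq_bac]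
    _ = word [.a, .c, .a, .c, .a] := by simp [mul_assoc]
    _ = word [.c, .a, .c, .a, .c] := acaca_eq_cacac
    _ = word [.c, .a, .c] * word [.a, .c] := by simp [mul_assoc]

lemma acaca_eq_caacb : word [.a, .c, .a, .c, .a] = word [.c, .a, .a, .c, .b] := by
  calc word [.a, .c, .a, .c, .a]
      = word [.c, .a] * word [.c, .a, .c] := by rw [acaca_eq_cacac]; simp [mul_assoc]
    _ = word [.c, .a, .a, .c, .b] := by rw [← acb_eq_cac]; simp [mul_assoc]

lemma permHom_word (l : List Gen3) : permHom (word l) = (l.map toPerm).prod := by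
  induction l with
  | nil => simp
  | cons s l ih => simp [ih]

/-- Positive words with the same value in `G` have the same image in the symmetric group. -/
lemma prod_toPerm_eq {l k : List Gen3} (h : word l = word k) :
    (l.map toPerm).prod = (k.map toPerm).prod := by
  rw [← permHom_word, ← permHom_word, h]

/-- No positive word is left-divisible by `a` and `b` and left-divides both `aca` and `abab`. -/
lemma no_left_lcm {u v p q : List Gen3} (huv : word (.a :: u) = word (.b :: v))
    (hp : word (.a :: u ++ p) = word [.a, .c, .a])
    (hq : word (.a :: u ++ q) = word [.a, .b, .a, .b]) : False := by
  have luv := length_eq_of_word_eq huv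
  have lp := length_eq_of_word_eq hp
  have lq := length_eq_of_word_eq hq
  have gen_ne : ∀ s t : Gen3,
      ([.a, s].map toPerm).prod ≠ ([.b, t].map toPerm).prod := by decide
  have aca_not_dvd : ∀ s : Gen3,
      ([.a, .c, .a, s].map toPerm).prod ≠ ([.a, .b, .a, .b].map toPerm).prod := by decide
  match u, v, p, q with
  | [], [], _, _ => exact absurd (prod_toPerm_eq huv) (by decide)
  | [s], [t], _, _ => exact gen_ne s t (prod_toPerm_eq huv)
  | [s, t], _, [], [r] =>
    refine aca_not_dvd r (prod_toPerm_eq (Eq.trans ?_ hq))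
    rw [List.append_nil] at hp
    rw [word_append, hp, ← word_append]
    rfl

/-- No positive word is right-divisible by `a` and `b` and right-divides both `abab` and
`acaca`. -/
lemma no_right_lcm {u v p q : List Gen3} (huv : word (u ++ [.a]) = word (v ++ [.b]))
    (hp : word (p ++ (u ++ [.a])) = word [.a, .b, .a, .b])
    (hq : word (q ++ (u ++ [.a])) = word [.a, .c, .a, .c, .a]) : False := by
  have luv : u.length = v.length := by simpa using length_eq_of_word_eq huv
  have lp : p.length + u.length = 3 := by simpa [← add_assoc] using length_eq_of_word_eq hp
  have lq : q.length + u.length = 4 := by simpa [← add_assoc] using length_eq_of_word_eq hq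
  have gen_ne : ∀ s t : Gen3,
      ([s, .a].map toPerm).prod ≠ ([t, .b].map toPerm).prod := by decide
  have no_length_three : ∀ s t x r y : Gen3,
      ([t, r, .a].map toPerm).prod = ([x, y, .b].map toPerm).prod →
      ([s, t, r, .a].map toPerm).prod ≠ ([.a, .b, .a, .b].map toPerm).prod := by decide
  have abab_not_dvd : ∀ s : Gen3,
      ([s, .a, .b, .a, .b].map toPerm).prod ≠ ([.a, .c, .a, .c, .a].map toPerm).prod := by
    decide
  match u, v, p, q with
  | [], [], _, _ => exact absurd (prod_toPerm_eq huv) (by decide)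
  | [s], [t], _, _ => exact gen_ne s t (prod_toPerm_eq huv)
  | [t, r], [x, y], [s], _ =>
    exact no_length_three s t x r y (prod_toPerm_eq huv) (prod_toPerm_eq hp)
  | [_, _, _], _, [], [s] =>
    refine abab_not_dvd s (prod_toPerm_eq (Eq.trans ?_ hq))
    rw [List.nil_append] at hp
    rw [word_append, hp, ← word_append]
    rfl

end G

/-- `G_Hii⁺` admits neither the left- nor the right-divisibility theory: it is not
the case that any two elements have a left least common multiple, nor that any two
elements have a right least common multiple. -/
theorem Gplus_no_divisibility_theory :
    (¬ ∀ x y : Gplus, ∃ m : Gplus,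
        (∃ w : Gplus, m = x * w) ∧ (∃ w : Gplus, m = y * w) ∧
        ∀ n : Gplus, (∃ w : Gplus, n = x * w) → (∃ w : Gplus, n = y * w) →
          ∃ w : Gplus, n = m * w) ∧
    (¬ ∀ x y : Gplus, ∃ m : Gplus,
        (∃ w : Gplus, m = w * x) ∧ (∃ w : Gplus, m = w * y) ∧
        ∀ n : Gplus, (∃ w : Gplus, n = w * x) → (∃ w : Gplus, n = w * y) →
          ∃ w : Gplus, n = w * m) := by
  constructor
  · intro h
    obtain ⟨m, ⟨u, mu⟩, ⟨v, mv⟩, hlcm⟩ :=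
      h ⟨_, G.gen_mem_Gplus .a⟩ ⟨_, G.gen_mem_Gplus .b⟩
    obtain ⟨p, hp⟩ := hlcm ⟨_, G.word_mem_Gplus [.a, .c, .a]⟩
      ⟨⟨_, G.word_mem_Gplus [.c, .a]⟩, Subtype.ext (G.word_cons _ _)⟩
      ⟨⟨_, G.word_mem_Gplus [.a, .c]⟩, Subtype.ext (G.aca_eq_bac.trans (G.word_cons _ _))⟩
    obtain ⟨q, hq⟩ := hlcm ⟨_, G.word_mem_Gplus [.a, .b, .a, .b]⟩
      ⟨⟨_, G.word_mem_Gplus [.b, .a, .b]⟩, Subtype.ext (G.word_cons _ _)⟩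
      ⟨⟨_, G.word_mem_Gplus [.a, .b, .a]⟩, Subtype.ext (G.abab_eq_baba.trans (G.word_cons _ _))⟩
    obtain ⟨lu, hu⟩ := G.exists_eq_word u.2
    obtain ⟨lv, hv⟩ := G.exists_eq_word v.2
    obtain ⟨lp, hlp⟩ := G.exists_eq_word p.2
    obtain ⟨lq, hlq⟩ := G.exists_eq_word q.2
    have ma : (m : G) = G.word (.a :: lu) := by rw [mu, G.word_cons, ← hu]; rfl
    have mb : (m : G) = G.word (.b :: lv) := by rw [mv, G.word_cons, ← hv]; rfl
    refine G.no_left_lcm (ma.symm.trans mb) (p := lp) (q := lq) ?_ ?_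
    · rw [G.word_append, ← ma, ← hlp]; exact (congrArg Subtype.val hp).symm
    · rw [G.word_append, ← ma, ← hlq]; exact (congrArg Subtype.val hq).symm
  · intro h
    obtain ⟨m, ⟨u, mu⟩, ⟨v, mv⟩, hlcm⟩ :=
      h ⟨_, G.word_mem_Gplus [.a]⟩ ⟨_, G.word_mem_Gplus [.b]⟩
    obtain ⟨p, hp⟩ := hlcm ⟨_, G.word_mem_Gplus [.a, .b, .a, .b]⟩
      ⟨⟨_, G.word_mem_Gplus [.b, .a, .b]⟩,
        Subtype.ext (G.abab_eq_baba.trans (G.word_append [.b, .a, .b] [.a]))⟩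
      ⟨⟨_, G.word_mem_Gplus [.a, .b, .a]⟩, Subtype.ext (G.word_append [.a, .b, .a] [.b])⟩
    obtain ⟨q, hq⟩ := hlcm ⟨_, G.word_mem_Gplus [.a, .c, .a, .c, .a]⟩
      ⟨⟨_, G.word_mem_Gplus [.a, .c, .a, .c]⟩,
        Subtype.ext (G.word_append [.a, .c, .a, .c] [.a])⟩
      ⟨⟨_, G.word_mem_Gplus [.c, .a, .a, .c]⟩,
        Subtype.ext (G.acaca_eq_caacb.trans (G.word_append [.c, .a, .a, .c] [.b]))⟩
    obtain ⟨lu, hu⟩ := G.exists_eq_word u.2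
    obtain ⟨lv, hv⟩ := G.exists_eq_word v.2
    obtain ⟨lp, hlp⟩ := G.exists_eq_word p.2
    obtain ⟨lq, hlq⟩ := G.exists_eq_word q.2
    have ma : (m : G) = G.word (lu ++ [.a]) := by rw [mu, G.word_append, ← hu]; rfl
    have mb : (m : G) = G.word (lv ++ [.b]) := by rw [mv, G.word_append, ← hv]; rfl
    refine G.no_right_lcm (ma.symm.trans mb) (p := lp) (q := lq) ?_ ?_
    · rw [G.word_append, ← ma, ← hlp]; exact (congrArg Subtype.val hp).symm
    · rw [G.word_append, ← ma, ← hlq]; exact (congrArg Subtype.val hq).symm
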